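/- In the group G_n (for any integer n ≥ 0), the identity a·d⁻¹·a = b·c⁻¹·b holds. -/

import Mathlib

/-- The four generators of the Kanenobu group `G n`. -/
inductive Gen : Type
  | a | b | c | d
  deriving DecidableEq

open FreeGroup in
/-- The four relators of the presentation of `G n`. -/
def kanenobuRels (n : ℕ) : Set (FreeGroup Gen) :=
  { ((of Gen.a)⁻¹ * of Gen.b) ^ (10 * n) * (of Gen.d)⁻¹ * (of Gen.a) ^ 2,
    ((of Gen.b)⁻¹) ^ 2 * of Gen.c * ((of Gen.b)⁻¹ * of Gen.a) ^ (10 * n),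
    ((of Gen.d)⁻¹ * of Gen.c) ^ (10 * n + 3) * (of Gen.c)⁻¹ * of Gen.b * ((of Gen.c)⁻¹) ^ 2,
    (of Gen.d) ^ 2 * (of Gen.a)⁻¹ * of Gen.d * ((of Gen.c)⁻¹ * of Gen.d) ^ (10 * n + 3) }

/-- The group `G n`, fundamental group of the double branched cover of `K_{-10n,10n+3}`. -/
abbrev G (n : ℕ) : Type := PresentedGroup (kanenobuRels n)

/-- The image of the generator `a` in `G n`. -/
def ga (n : ℕ) : G n := PresentedGroup.of Gen.a
/-- The image of the generator `b` in `G n`. -/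
def gb (n : ℕ) : G n := PresentedGroup.of Gen.b
/-- The image of the generator `c` in `G n`. -/
def gc (n : ℕ) : G n := PresentedGroup.of Gen.c
/-- The image of the generator `d` in `G n`. -/
def gd (n : ℕ) : G n := PresentedGroup.of Gen.d

/-- `lt` is a left-invariant linear (strict total) order on the group `G`. -/
def IsLeftInvariantLinearOrder (G : Type*) [Group G] (lt : G → G → Prop) : Prop :=
  IsStrictTotalOrder G lt ∧ ∀ f g h : G, lt g h → lt (f * g) (f * h)

theorem aux_group {H : Type*} [Group H] (a b c d : H) (k : ℕ)
    (h1 : (a⁻¹ * b) ^ k * d⁻¹ * a ^ 2 = 1)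
    (h2 : (b⁻¹) ^ 2 * c * (b⁻¹ * a) ^ k = 1) :
    a * d⁻¹ * a = b * c⁻¹ * b := by
  have hx : b⁻¹ * a = (a⁻¹ * b)⁻¹ := by group
  rw [hx, inv_pow, inv_pow] at h2
  have hc : (a⁻¹ * b) * (a⁻¹ * b) ^ k = (a⁻¹ * b) ^ k * (a⁻¹ * b) :=
    (Commute.refl _).pow_right k
  generalize (a⁻¹ * b) ^ k = P at *
  have hd : d = a ^ 2 * P := by
    have h : d = a ^ 2 * (P * d⁻¹ * a ^ 2)⁻¹ * P * 1 := by group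
    rw [h1] at h
    simpa using h
  have hcc : c = b ^ 2 * P := by
    have h : c = b ^ 2 * ((b ^ 2)⁻¹ * c * P⁻¹) * P := by group
    rw [h2] at h
    simpa using h
  have hP : a⁻¹ * b * P⁻¹ = P⁻¹ * (a⁻¹ * b) := by
    rw [mul_inv_eq_iff_eq_mul, mul_assoc, hc]; group
  have e2 : b * c⁻¹ * b = a * (a⁻¹ * b * P⁻¹) * b⁻¹ := by rw [hcc]; group
  rw [e2, hP, hd]; group

/-- In `G n`, `a·d⁻¹·a = b·c⁻¹·b`. -/
theorem rel_a_dinv_a (n : ℕ) :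
    ga n * (gd n)⁻¹ * ga n = gb n * (gc n)⁻¹ * gb n := by
  have r : ∀ w ∈ kanenobuRels n, PresentedGroup.mk (kanenobuRels n) w = 1 :=
    fun w hw => PresentedGroup.one_of_mem hw
  have h1 := r _ (Or.inl rfl)
  have h2 := r _ (Or.inr (Or.inl rfl))
  simp only [map_mul, map_pow, map_inv] at h1 h2
  exact aux_group (ga n) (gb n) (gc n) (gd n) (10 * n) h1 h2
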